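/- Let w : ℕ → ℝ be defined by w(0) = 0 and w(k) = 2k(k+3)/((k+1)(k+2)) for k ≥ 1, let d : ℕ → ℝ be defined by d(0) = 0 and d(k) = (3/280)·(k(k+3)/((k+1)(k+2)))·(5k⁴ + 30k³ + 59k² + 42k + 4) for k ≥ 1, and for k ≥ 1 set q(k) = w(k)²·d(k-1)/(12·d(k)) and p(k) = w(k)²·d(k+1)/(12·d(k)). For i ≥ 2 and ℓ ≥ 0 set m(i,ℓ) = ∏_{t=0}^{ℓ-1} q(i+t)/p(i+t), and for k ≥ 1 set σ(k) = (∑_{ℓ=0}^∞ m(k+1,ℓ))/p(k). A labeled walk from k to j (k, j ≥ 1) is a finite sequence θ = (θ_0, θ_1, …, θ_L) of positive integers, L ≥ 0, with θ_0 = k, θ_L = j and |θ_{t+1} - θ_t| ≤ 1 for 0 ≤ t < L; its weight is 12^{-L}·∏_{t=0}^{L-1} w(θ_t)·w(θ_{t+1}); let G(k,j) ∈ [0,∞] be the sum of the weights of all labeled walks from k to j. Then for every j ≥ 1 the sum E(j) := 2·∑_{k=1}^∞ σ(k)·G(k,j) - σ(j) is finite, and there exist constants 0 < c ≤ C such that c·j³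 ≤ E(j) ≤ C·j³ for all j ≥ 1. -/

import Mathlib

open scoped ENNReal

/-- `wseq k = W^{(k)}(1/12)`. Note `wseq 0 = 0`. -/
noncomputable def wseq (k : ℕ) : ℝ := 2 * k * (k + 3) / ((k + 1) * (k + 2))

/-- A labeled walk from `k` to `j` of length `L`, encoded as a function
`θ : ℕ → ℕ` with `θ 0 = k`, `θ t = j` for all `t ≥ L` (so in particular
`θ L = j`), consecutive values differing by at most 1 up to time `L`, and all
values positive. -/
def IsLWalk (k j L : ℕ) (θ : ℕ → ℕ) : Prop :=
  θ 0 = k ∧ (∀ t : ℕ, L ≤ t → θ t = j) ∧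
    (∀ t : ℕ, t < L → θ (t + 1) ≤ θ t + 1 ∧ θ t ≤ θ (t + 1) + 1) ∧
    (∀ t : ℕ, 1 ≤ θ t)

/-- The type of labeled walks from `k` to `j`: a length together with the
sequence of labels. -/
def LWalk (k j : ℕ) : Type :=
  { x : ℕ × (ℕ → ℕ) // IsLWalk k j x.1 x.2 }

/-- The weight `12^{-L} ∏_{t<L} w(θ_t) w(θ_{t+1})` of a walk, in `[0,∞]`. -/
noncomputable def walkWeight (L : ℕ) (θ : ℕ → ℕ) : ℝ≥0∞ :=
  (∏ t ∈ Finset.range L, ENNReal.ofReal (wseq (θ t) * wseq (θ (t + 1)))) /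
    12 ^ L

/-- `Gfun k j ∈ [0,∞]` is the sum of the weights of all labeled walks from `k`
to `j`.  (For `j = 0` there are no such walks, so `Gfun k 0 = 0`.) -/
noncomputable def Gfun (k j : ℕ) : ℝ≥0∞ :=
  ∑' x : LWalk k j, walkWeight x.1.1 x.1.2

/-- `dseq k` is the limit of `D_N^{(k)}/D_N` as `N → ∞`. Note `dseq 0 = 0`. -/
noncomputable def dseq (k : ℕ) : ℝ :=
  (3 / 280) * ((k : ℝ) * (k + 3) / ((k + 1) * (k + 2))) *
    (5 * (k : ℝ) ^ 4 + 30 * (k : ℝ) ^ 3 + 59 * (k : ℝ) ^ 2 + 42 * k + 4)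

/-- probability of a down-step `k → k-1` of the birth and death process. -/
noncomputable def qseq (k : ℕ) : ℝ := (wseq k) ^ 2 * dseq (k - 1) / (12 * dseq k)

/-- probability of an up-step `k → k+1` of the birth and death process. -/
noncomputable def pseq (k : ℕ) : ℝ := (wseq k) ^ 2 * dseq (k + 1) / (12 * dseq k)

/-- `mseq i ℓ = ∏_{t=0}^{ℓ-1} q(i+t)/p(i+t)`. -/
noncomputable def mseq (i ℓ : ℕ) : ℝ :=
  ∏ t ∈ Finset.range ℓ, qseq (i + t) / pseq (i + t)

/-- `σ(k) = (∑_{ℓ≥0} m(k+1,ℓ))/p(k)`, the expected sojourn time at level `k`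
of the birth and death process along the spine, as an element of `[0,∞]`. -/
noncomputable def sigE (k : ℕ) : ℝ≥0∞ :=
  (∑' ℓ : ℕ, ENNReal.ofReal (mseq (k + 1) ℓ)) / ENNReal.ofReal (pseq k)

open scoped Classical in
/-- The total weight of the labeled walks of length `L` from `k` to `j`. -/
noncomputable def walkSum (L k j : ℕ) : ℝ≥0∞ :=
  ∑' θ : ℕ → ℕ, if IsLWalk k j L θ then walkWeight L θ else 0

/-- The one-step kernel of labeled walks. -/
noncomputable def stepWeight (k l : ℕ) : ℝ≥0∞ :=
  if l ≤ k + 1 ∧ k ≤ l + 1 then ENNReal.ofReal (wseq k * wseq l) / 12 else 0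

/-- The left action of the one-step kernel on functions. -/
noncomputable def stepApply (f : ℕ → ℝ≥0∞) (l : ℕ) : ℝ≥0∞ :=
  ∑' k, f k * stepWeight k l

/-- The total weight of walks of length `L` ending at `j`, with initial weight `f`. -/
noncomputable def walkMass (f : ℕ → ℝ≥0∞) (L j : ℕ) : ℝ≥0∞ :=
  ∑' k, f k * walkSum L k j

/-- Splitting a sequence into its first term and its tail. -/
def consNatEquiv : ℕ × (ℕ → ℕ) ≃ (ℕ → ℕ) where
  toFun x n := Nat.casesOn n x.1 x.2
  invFun θ := (θ 0, fun n => θ (n + 1))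
  left_inv _ := rfl
  right_inv θ := by funext n; cases n <;> rfl

theorem wseq_zero : wseq 0 = 0 := by simp [wseq]

theorem wseq_nonneg (k : ℕ) : 0 ≤ wseq k := by unfold wseq; positivity

theorem Gfun_eq_tsum_walkSum (k j : ℕ) : Gfun k j = ∑' L, walkSum L k j := by
  classical
  unfold Gfun walkSum
  rw [← ENNReal.tsum_prod
    (f := fun (L : ℕ) (θ : ℕ → ℕ) => if IsLWalk k j L θ then walkWeight L θ else 0)]
  refine (tsum_subtype {x : ℕ × (ℕ → ℕ) | IsLWalk k j x.1 x.2}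
    (fun x => walkWeight x.1 x.2)).trans ?_
  refine tsum_congr fun x => ?_
  simp [Set.indicator_apply]

theorem isLWalk_zero_iff {k j : ℕ} (hj : 1 ≤ j) (θ : ℕ → ℕ) :
    IsLWalk k j 0 θ ↔ θ = (fun _ => j) ∧ k = j := by
  constructor
  · rintro ⟨h0, h1, -, -⟩
    exact ⟨funext fun t => h1 t (Nat.zero_le t), by rw [← h0, h1 0 le_rfl]⟩
  · rintro ⟨rfl, rfl⟩
    exact ⟨rfl, fun _ _ => rfl, fun t ht => absurd ht (by omega), fun _ => hj⟩

theorem walkSum_zero {j : ℕ} (hj : 1 ≤ j) (k : ℕ) :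
    walkSum 0 k j = if k = j then 1 else 0 := by
  classical
  unfold walkSum
  rw [tsum_eq_single (fun _ => j)]
  · simp [isLWalk_zero_iff hj, walkWeight]
  · intro θ hθ
    simp [isLWalk_zero_iff hj, hθ]

theorem isLWalk_succ_cons_iff (k j L c : ℕ) (η : ℕ → ℕ) :
    IsLWalk k j (L + 1) (consNatEquiv (c, η)) ↔
      c = k ∧ 1 ≤ k ∧ (η 0 ≤ k + 1 ∧ k ≤ η 0 + 1) ∧ IsLWalk (η 0) j L η := by
  constructor
  · rintro ⟨h0, h1, h2, h3⟩
    have h0' : c = k := h0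
    subst h0'
    exact ⟨rfl, h3 0, h2 0 (by omega), rfl, fun t ht => h1 (t + 1) (by omega),
      fun t ht => h2 (t + 1) (by omega), fun t => h3 (t + 1)⟩
  · rintro ⟨rfl, hc, hn, -, h1, h2, h3⟩
    refine ⟨rfl, fun t ht => ?_, fun t ht => ?_, fun t => ?_⟩
    · obtain _ | t := t
      · omega
      · exact h1 t (by omega)
    · obtain _ | t := t
      · exact hn
      · exact h2 t (by omega)
    · obtain _ | t := t
      · exact hc
      · exact h3 t

theorem walkWeight_succ_cons (L c : ℕ) (η : ℕ → ℕ) :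
    walkWeight (L + 1) (consNatEquiv (c, η)) =
      ENNReal.ofReal (wseq c * wseq (η 0)) / 12 * walkWeight L η := by
  unfold walkWeight
  rw [Finset.prod_range_succ']
  simp only [ENNReal.div_eq_inv_mul]
  rw [pow_succ, ENNReal.mul_inv (by simp) (by simp)]
  change _ * ((∏ t ∈ Finset.range L, ENNReal.ofReal (wseq (η t) * wseq (η (t + 1)))) *
    ENNReal.ofReal (wseq c * wseq (η 0))) = _
  ring

theorem walkSum_succ (L k j : ℕ) :
    walkSum (L + 1) k j = ∑' l, stepWeight k l * walkSum L l j := by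
  classical
  unfold walkSum
  rw [← consNatEquiv.tsum_eq, ENNReal.tsum_prod', tsum_eq_single k]
  · simp_rw [← ENNReal.tsum_mul_left]
    rw [ENNReal.tsum_comm]
    refine tsum_congr fun η => ?_
    rw [tsum_eq_single (η 0)]
    · rw [walkWeight_succ_cons]
      simp only [isLWalk_succ_cons_iff, stepWeight, true_and]
      rcases Nat.eq_zero_or_pos k with rfl | hk
      · simp [wseq_zero]
      · by_cases h1 : η 0 ≤ k + 1 ∧ k ≤ η 0 + 1 <;> by_cases h2 : IsLWalk (η 0) j L η <;>
          simp [h1, h2, hk, Nat.succ_le_iff]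
    · intro l hl
      rw [if_neg fun h => hl h.1.symm, mul_zero]
  · intro c hc
    simp [isLWalk_succ_cons_iff, hc]

theorem walkMass_zero (f : ℕ → ℝ≥0∞) {j : ℕ} (hj : 1 ≤ j) : walkMass f 0 j = f j := by
  simp [walkMass, walkSum_zero hj]

theorem walkMass_succ (f : ℕ → ℝ≥0∞) (L j : ℕ) :
    walkMass f (L + 1) j = walkMass (stepApply f) L j := by
  simp only [walkMass, walkSum_succ, stepApply, ← ENNReal.tsum_mul_left, ← ENNReal.tsum_mul_right]
  rw [ENNReal.tsum_comm]
  simp only [mul_assoc]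

theorem walkMass_mono {f g : ℕ → ℝ≥0∞} (h : ∀ k, f k ≤ g k) (L j : ℕ) :
    walkMass f L j ≤ walkMass g L j :=
  ENNReal.tsum_le_tsum fun k => mul_le_mul_left (h k) _

theorem walkMass_add (f g : ℕ → ℝ≥0∞) (L j : ℕ) :
    walkMass (fun k => f k + g k) L j = walkMass f L j + walkMass g L j := by
  simp only [walkMass, add_mul, ENNReal.tsum_add]

theorem walkMass_const_mul (c : ℝ≥0∞) (f : ℕ → ℝ≥0∞) (L j : ℕ) :
    walkMass (fun k => c * f k) L j = c * walkMass f L j := by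
  simp only [walkMass, mul_assoc, ENNReal.tsum_mul_left]

theorem tsum_mul_Gfun (f : ℕ → ℝ≥0∞) (j : ℕ) :
    ∑' k, f k * Gfun k j = ∑' L, walkMass f L j := by
  simp only [Gfun_eq_tsum_walkSum, walkMass, ← ENNReal.tsum_mul_left]
  exact ENNReal.tsum_comm

/-- A supersolution dominates the potential. -/
theorem tsum_walkMass_le {s h : ℕ → ℝ≥0∞} (hs : ∀ k, s k + stepApply h k ≤ h k)
    {j : ℕ} (hj : 1 ≤ j) : ∑' L, walkMass s L j ≤ h j := by
  have key : ∀ N, ∑ L ∈ Finset.range N, walkMass s L j + walkMass h N j ≤ h j := by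
    intro N
    induction N with
    | zero => simp [walkMass_zero h hj]
    | succ N ih =>
      refine le_trans ?_ ih
      rw [Finset.sum_range_succ, add_assoc, walkMass_succ, ← walkMass_add]
      exact add_le_add le_rfl (walkMass_mono hs N j)
  exact ENNReal.tsum_le_of_sum_range_le fun N => le_self_add.trans (key N)

/-- A subsolution controlled by the source is dominated by the potential. -/
theorem le_tsum_walkMass {s v : ℕ → ℝ≥0∞} (hv : ∀ k, v k ≤ s k + stepApply v k)
    {M : ℝ≥0∞} (hM : M ≠ ⊤) (hvs : ∀ k, v k ≤ M * s k)
    {j : ℕ} (hj : 1 ≤ j) (hfin : ∑' L, walkMass s L j ≠ ⊤) :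
    v j ≤ ∑' L, walkMass s L j := by
  have key : ∀ N, v j ≤ ∑ L ∈ Finset.range N, walkMass s L j + walkMass v N j := by
    intro N
    induction N with
    | zero => simp [walkMass_zero v hj]
    | succ N ih =>
      refine ih.trans ?_
      rw [Finset.sum_range_succ, add_assoc, walkMass_succ, ← walkMass_add]
      exact add_le_add le_rfl (walkMass_mono hv N j)
  have hbound : ∀ N, v j ≤ ∑' L, walkMass s L j + M * walkMass s N j := fun N => by
    refine (key N).trans (add_le_add (ENNReal.sum_le_tsum _) ?_)
    rw [← walkMass_const_mul]
    exact walkMass_mono hvs N j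
  have hlim : Filter.Tendsto (fun N => walkMass s N j) Filter.atTop (nhds 0) :=
    ENNReal.tendsto_atTop_zero_of_tsum_ne_top hfin
  have hlim' := (ENNReal.Tendsto.const_mul hlim (Or.inr hM)).const_add (∑' L, walkMass s L j)
  rw [mul_zero, add_zero] at hlim'
  exact ge_of_tendsto' hlim' hbound

theorem wseq_pos {k : ℕ} (hk : 1 ≤ k) : 0 < wseq k := by
  have : (0 : ℝ) < k := by exact_mod_cast hk
  unfold wseq; positivity

theorem wseq_le_two (k : ℕ) : wseq k ≤ 2 := by
  unfold wseq
  rw [div_le_iff₀ (by positivity)]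
  nlinarith

theorem one_le_wseq {k : ℕ} (hk : 1 ≤ k) : 1 ≤ wseq k := by
  have : (1 : ℝ) ≤ k := by exact_mod_cast hk
  unfold wseq
  rw [le_div_iff₀ (by positivity)]
  nlinarith

theorem dseq_zero : dseq 0 = 0 := by simp [dseq]

theorem le_dseq (k : ℕ) : (k : ℝ) ^ 4 / 28 ≤ dseq k := by
  rcases Nat.eq_zero_or_pos k with rfl | hk
  · simp [dseq]
  have hk' : (1 : ℝ) ≤ k := by exact_mod_cast hk
  have h1 : (2 / 3 : ℝ) ≤ (k : ℝ) * (k + 3) / ((k + 1) * (k + 2)) := by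
    rw [le_div_iff₀ (by positivity)]
    nlinarith
  have h2 : 5 * (k : ℝ) ^ 4 ≤
      5 * (k : ℝ) ^ 4 + 30 * (k : ℝ) ^ 3 + 59 * (k : ℝ) ^ 2 + 42 * k + 4 := by
    have : 0 ≤ 30 * (k : ℝ) ^ 3 + 59 * (k : ℝ) ^ 2 + 42 * k + 4 := by positivity
    linarith
  have := mul_le_mul h1 h2 (by positivity) (by positivity)
  unfold dseq
  linarith

theorem dseq_le (k : ℕ) : dseq k ≤ 3 / 2 * (k : ℝ) ^ 4 := by
  rcases Nat.eq_zero_or_pos k with rfl | hk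
  · simp [dseq]
  have hk' : (1 : ℝ) ≤ k := by exact_mod_cast hk
  have h1 : (k : ℝ) * (k + 3) / ((k + 1) * (k + 2)) ≤ 1 := by
    rw [div_le_iff₀ (by positivity)]
    nlinarith
  have h2 : 5 * (k : ℝ) ^ 4 + 30 * (k : ℝ) ^ 3 + 59 * (k : ℝ) ^ 2 + 42 * k + 4 ≤
      140 * (k : ℝ) ^ 4 := by
    have a1 : (k : ℝ) ^ 3 ≤ (k : ℝ) ^ 4 := pow_le_pow_right₀ hk' (by norm_num)
    have a2 : (k : ℝ) ^ 2 ≤ (k : ℝ) ^ 4 := pow_le_pow_right₀ hk' (by norm_num)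
    have a3 : (k : ℝ) ≤ (k : ℝ) ^ 4 := le_self_pow₀ hk' (by norm_num)
    have a4 : 1 ≤ (k : ℝ) ^ 4 := one_le_pow₀ hk'
    linarith
  have := mul_le_mul h1 h2 (by positivity) (by positivity)
  unfold dseq
  linarith

theorem dseq_pos {k : ℕ} (hk : 1 ≤ k) : 0 < dseq k := by
  have : (0 : ℝ) < k := by exact_mod_cast hk
  exact lt_of_lt_of_le (by positivity) (le_dseq k)

/-- `dseq` is harmonic for the spine kernel. -/
theorem dseq_div_wseq (l : ℕ) :
    dseq (l + 1) / wseq (l + 1) =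
      wseq (l + 1) / 12 * (dseq l + dseq (l + 1) + dseq (l + 2)) := by
  unfold dseq wseq
  push_cast
  have h0 : (l : ℝ) + 1 ≠ 0 := by positivity
  have h2 : (l : ℝ) + 1 + 1 ≠ 0 := by positivity
  have h3 : (l : ℝ) + 1 + 2 ≠ 0 := by positivity
  have h4 : (l : ℝ) + 1 + 3 ≠ 0 := by positivity
  have h5 : (l : ℝ) + 2 ≠ 0 := by positivity
  have h6 : (l : ℝ) + 2 + 1 ≠ 0 := by positivity
  have h7 : (l : ℝ) + 2 + 2 ≠ 0 := by positivity
  field_simp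
  ring

/-- A cubic whose defect under the spine kernel is of linear order. -/
noncomputable def cubic (k : ℕ) : ℝ := k * (k + 3) * (2 * k + 3)

theorem cubic_zero : cubic 0 = 0 := by simp [cubic]

theorem cubic_nonneg (k : ℕ) : 0 ≤ cubic k := by unfold cubic; positivity

theorem le_cubic (k : ℕ) : (k : ℝ) ^ 3 ≤ cubic k := by
  have : (0 : ℝ) ≤ (k : ℝ) ^ 3 + 9 * (k : ℝ) ^ 2 + 9 * k := by positivity
  unfold cubic
  nlinarith

theorem cubic_le (k : ℕ) : cubic k ≤ 20 * (k : ℝ) ^ 3 := by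
  rcases Nat.eq_zero_or_pos k with rfl | hk
  · simp [cubic]
  have hk' : (1 : ℝ) ≤ k := by exact_mod_cast hk
  have a2 : (k : ℝ) ^ 2 ≤ (k : ℝ) ^ 3 := pow_le_pow_right₀ hk' (by norm_num)
  have a3 : (k : ℝ) ≤ (k : ℝ) ^ 3 := le_self_pow₀ hk' (by norm_num)
  unfold cubic
  nlinarith

theorem cubic_defect (l : ℕ) :
    cubic (l + 1) / wseq (l + 1) -
        wseq (l + 1) / 12 * (cubic l + cubic (l + 1) + cubic (l + 2)) =
      wseq (l + 1) / 12 *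
        ((2 * ((l + 1 : ℕ) : ℝ) + 3) * (6 + 12 / (((l + 1 : ℕ) : ℝ) * ((l + 1 : ℕ) + 3)))) := by
  unfold cubic wseq
  push_cast
  have h0 : (l : ℝ) + 1 ≠ 0 := by positivity
  have h2 : (l : ℝ) + 1 + 1 ≠ 0 := by positivity
  have h3 : (l : ℝ) + 1 + 2 ≠ 0 := by positivity
  have h4 : (l : ℝ) + 1 + 3 ≠ 0 := by positivity
  field_simp
  ring

theorem le_cubic_defect (l : ℕ) :
    ((l + 1 : ℕ) : ℝ) ≤ cubic (l + 1) / wseq (l + 1) -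
        wseq (l + 1) / 12 * (cubic l + cubic (l + 1) + cubic (l + 2)) := by
  rw [cubic_defect]
  have hw := one_le_wseq (Nat.le_add_left 1 l)
  set x : ℝ := ((l + 1 : ℕ) : ℝ)
  have hx : (1 : ℝ) ≤ x := by simp [x]
  have h1 : 0 ≤ 12 / (x * (x + 3)) := by positivity
  have h2 : 12 * x ≤ (2 * x + 3) * (6 + 12 / (x * (x + 3))) := by nlinarith
  nlinarith

theorem cubic_defect_le (l : ℕ) :
    cubic (l + 1) / wseq (l + 1) -
        wseq (l + 1) / 12 * (cubic l + cubic (l + 1) + cubic (l + 2)) ≤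
      8 * ((l + 1 : ℕ) : ℝ) := by
  rw [cubic_defect]
  have hw := wseq_le_two (l + 1)
  have hw0 := wseq_nonneg (l + 1)
  set x : ℝ := ((l + 1 : ℕ) : ℝ)
  have hx : (1 : ℝ) ≤ x := by simp [x]
  have h0 : 0 ≤ 12 / (x * (x + 3)) := by positivity
  have h1 : 12 / (x * (x + 3)) ≤ 3 := by
    rw [div_le_iff₀ (by positivity)]
    nlinarith
  have h2 : (2 * x + 3) * (6 + 12 / (x * (x + 3))) ≤ 48 * x := by nlinarith
  have h3 : 0 ≤ (2 * x + 3) * (6 + 12 / (x * (x + 3))) := by positivity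
  nlinarith

theorem stepApply_zero (f : ℕ → ℝ≥0∞) : stepApply f 0 = 0 := by
  simp [stepApply, stepWeight, wseq_zero]

theorem stepApply_ofReal_div {φ : ℕ → ℝ} (hφ : ∀ k, 0 ≤ φ k) (h0 : φ 0 = 0) (l : ℕ) :
    stepApply (fun k => ENNReal.ofReal (φ k / wseq k)) (l + 1) =
      ENNReal.ofReal (wseq (l + 1) / 12 * (φ l + φ (l + 1) + φ (l + 2))) := by
  have hterm : ∀ k, k ≤ l + 1 + 1 → l + 1 ≤ k + 1 →
      ENNReal.ofReal (φ k / wseq k) * stepWeight k (l + 1) =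
        ENNReal.ofReal (wseq (l + 1) / 12 * φ k) := by
    intro k h1 h2
    rw [stepWeight, if_pos ⟨h2, h1⟩, ← ENNReal.ofReal_ofNat,
      ← ENNReal.ofReal_div_of_pos (by norm_num),
      ← ENNReal.ofReal_mul (div_nonneg (hφ k) (wseq_nonneg k))]
    congr 1
    rcases Nat.eq_zero_or_pos k with rfl | hk
    · simp [h0]
    · have := (wseq_pos hk).ne'
      field_simp
  have hw := wseq_nonneg (l + 1)
  unfold stepApply
  rw [tsum_eq_sum (s := {l, l + 1, l + 2})]
  · rw [Finset.sum_insert (by simp), Finset.sum_insert (by simp), Finset.sum_singleton,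
      hterm l (by omega) (by omega), hterm (l + 1) (by omega) (by omega),
      hterm (l + 2) (by omega) (by omega),
      ← ENNReal.ofReal_add (by have := hφ (l + 1); positivity) (by have := hφ (l + 2); positivity),
      ← ENNReal.ofReal_add (by have := hφ l; positivity)
        (by have := hφ (l + 1); have := hφ (l + 2); positivity)]
    congr 1
    ring
  · intro k hk
    simp only [Finset.mem_insert, Finset.mem_singleton, not_or] at hk
    rw [stepWeight, if_neg (by omega), mul_zero]

theorem qseq_div_pseq {k : ℕ} (hk : 1 ≤ k) : qseq k / pseq k = dseq (k - 1) / dseq (k + 1) := by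
  have h1 := (wseq_pos hk).ne'
  have h2 := (dseq_pos hk).ne'
  have h3 := (dseq_pos (Nat.le_add_left 1 k)).ne'
  unfold qseq pseq
  field_simp

theorem mseq_succ_eq {k : ℕ} (hk : 1 ≤ k) (l : ℕ) :
    mseq (k + 1) l = dseq k * dseq (k + 1) / (dseq (k + l) * dseq (k + l + 1)) := by
  have hpos : ∀ n, dseq (k + n) ≠ 0 := fun n => (dseq_pos (by omega)).ne'
  induction l with
  | zero =>
    have := hpos 0
    have := hpos 1
    simp only [mseq, Finset.range_zero, Finset.prod_empty, add_zero] at *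
    field_simp
  | succ l ih =>
    have h1 := hpos l
    have h2 : dseq (k + l + 1) ≠ 0 := hpos (l + 1)
    have h3 : dseq (k + l + 2) ≠ 0 := hpos (l + 2)
    rw [mseq, Finset.prod_range_succ, ← mseq, ih, qseq_div_pseq (by omega)]
    rw [show k + 1 + l - 1 = k + l by omega, show k + 1 + l + 1 = k + l + 2 by omega,
      show k + (l + 1) = k + l + 1 by omega, show k + l + 1 + 1 = k + l + 2 by omega]
    field_simp

theorem mseq_le {k : ℕ} (hk : 1 ≤ k) (l : ℕ) :
    mseq (k + 1) l ≤ 1764 * ((k : ℝ) * (k + 1)) * (1 / ((k + l : ℝ)) - 1 / (k + l + 1)) := by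
  have hk' : (1 : ℝ) ≤ k := by exact_mod_cast hk
  have hl : (0 : ℝ) ≤ l := Nat.cast_nonneg l
  rw [mseq_succ_eq hk]
  set x : ℝ := (k : ℝ) + l with hx
  have hkx : (k : ℝ) ≤ x := by linarith
  have hx0 : 0 < x := by linarith
  set a : ℝ := (k : ℝ) * (k + 1) with ha
  set b : ℝ := x * (x + 1) with hb
  have ha0 : 0 < a := by positivity
  have hb0 : 0 < b := by positivity
  have hab : a ≤ b := by
    rw [ha, hb]; gcongr
  have hnum : dseq k * dseq (k + 1) ≤ 9 / 4 * a ^ 4 := by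
    have h1 := dseq_le k
    have h2 := dseq_le (k + 1)
    push_cast at h2
    calc _ ≤ (3 / 2 * (k : ℝ) ^ 4) * (3 / 2 * ((k : ℝ) + 1) ^ 4) :=
          mul_le_mul h1 h2 (dseq_pos (by omega)).le (by positivity)
      _ = _ := by rw [ha]; ring
  have hden : b ^ 4 / 784 ≤ dseq (k + l) * dseq (k + l + 1) := by
    have h1 := le_dseq (k + l)
    have h2 := le_dseq (k + l + 1)
    push_cast at h1 h2
    rw [← hx] at h1 h2
    calc b ^ 4 / 784 = (x ^ 4 / 28) * ((x + 1) ^ 4 / 28) := by rw [hb]; ring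
      _ ≤ _ := mul_le_mul h1 h2 (by positivity) (dseq_pos (by omega)).le
  have hrhs : 1 / x - 1 / (x + 1) = 1 / b := by
    rw [hb]; field_simp; ring
  rw [hrhs]
  calc _ ≤ (9 / 4 * a ^ 4) / (b ^ 4 / 784) := by gcongr
    _ = 1764 * (a * a ^ 3) / (b * b ^ 3) := by field_simp; ring
    _ ≤ 1764 * (a * b ^ 3) / (b * b ^ 3) := by gcongr
    _ = 1764 * a * (1 / b) := by field_simp

theorem le_mseq {k l : ℕ} (hl : l < k) : (1 / 451584 : ℝ) ≤ mseq (k + 1) l := by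
  have hk : 1 ≤ k := by omega
  have hk' : (1 : ℝ) ≤ k := by exact_mod_cast hk
  have hl' : (l : ℝ) + 1 ≤ k := by exact_mod_cast hl
  rw [mseq_succ_eq hk]
  have hd1 : 0 < dseq (k + l) := dseq_pos (by omega)
  have hd2 : 0 < dseq (k + l + 1) := dseq_pos (by omega)
  have hnum : (k : ℝ) ^ 8 / 784 ≤ dseq k * dseq (k + 1) := by
    have h1 := le_dseq k
    have h2 : (k : ℝ) ^ 4 / 28 ≤ dseq (k + 1) := by
      refine le_trans ?_ (le_dseq (k + 1))
      push_cast
      gcongr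
      linarith
    calc (k : ℝ) ^ 8 / 784 = ((k : ℝ) ^ 4 / 28) * ((k : ℝ) ^ 4 / 28) := by ring
      _ ≤ _ := mul_le_mul h1 h2 (by positivity) (dseq_pos hk).le
  have hden : dseq (k + l) * dseq (k + l + 1) ≤ 576 * (k : ℝ) ^ 8 := by
    have h1 : dseq (k + l) ≤ 24 * (k : ℝ) ^ 4 := by
      refine (dseq_le _).trans ?_
      push_cast
      have : ((k : ℝ) + l) ^ 4 ≤ (2 * k) ^ 4 := by gcongr; linarith
      linarith [this, mul_pow (2 : ℝ) (k : ℝ) 4]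
    have h2 : dseq (k + l + 1) ≤ 24 * (k : ℝ) ^ 4 := by
      refine (dseq_le _).trans ?_
      push_cast
      have : ((k : ℝ) + l + 1) ^ 4 ≤ (2 * k) ^ 4 := by gcongr; linarith
      linarith [this, mul_pow (2 : ℝ) (k : ℝ) 4]
    calc _ ≤ (24 * (k : ℝ) ^ 4) * (24 * (k : ℝ) ^ 4) :=
          mul_le_mul h1 h2 hd2.le (by positivity)
      _ = _ := by ring
  rw [le_div_iff₀ (by positivity)]
  linarith

theorem tsum_mseq_le {k : ℕ} (hk : 1 ≤ k) :
    ∑' l, ENNReal.ofReal (mseq (k + 1) l) ≤ ENNReal.ofReal (3528 * k) := by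
  have hk' : (1 : ℝ) ≤ k := by exact_mod_cast hk
  have hnonneg : ∀ l, 0 ≤ mseq (k + 1) l := fun l => by
    rw [mseq_succ_eq hk]
    exact div_nonneg (mul_nonneg (dseq_pos hk).le (dseq_pos (by omega)).le)
      (mul_nonneg (dseq_pos (by omega)).le (dseq_pos (by omega)).le)
  refine ENNReal.tsum_le_of_sum_range_le fun N => ?_
  rw [← ENNReal.ofReal_sum_of_nonneg fun l _ => hnonneg l]
  refine ENNReal.ofReal_le_ofReal ?_
  have htel : ∑ l ∈ Finset.range N, (1 / ((k + l : ℝ)) - 1 / (k + l + 1)) ≤ 1 / k := by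
    have := Finset.sum_range_sub' (fun l : ℕ => 1 / ((k : ℝ) + l)) N
    push_cast at this
    simp only [← add_assoc] at this
    rw [this]
    have : 0 ≤ 1 / ((k : ℝ) + N) := by positivity
    simpa using this
  calc _ ≤ ∑ l ∈ Finset.range N,
        1764 * ((k : ℝ) * (k + 1)) * (1 / ((k + l : ℝ)) - 1 / (k + l + 1)) :=
        Finset.sum_le_sum fun l _ => mseq_le hk l
    _ = 1764 * ((k : ℝ) * (k + 1)) *
        ∑ l ∈ Finset.range N, (1 / ((k + l : ℝ)) - 1 / (k + l + 1)) := by rw [Finset.mul_sum]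
    _ ≤ 1764 * ((k : ℝ) * (k + 1)) * (1 / k) := by gcongr
    _ = 1764 * (k + 1) := by field_simp
    _ ≤ 3528 * k := by linarith

theorem le_tsum_mseq (k : ℕ) :
    ENNReal.ofReal (k / 451584) ≤ ∑' l, ENNReal.ofReal (mseq (k + 1) l) := by
  refine le_trans ?_ (ENNReal.sum_le_tsum (Finset.range k))
  calc ENNReal.ofReal (k / 451584) = ∑ l ∈ Finset.range k, ENNReal.ofReal (1 / 451584) := by
        rw [← ENNReal.ofReal_sum_of_nonneg fun _ _ => by positivity]
        congr 1
        simp [div_eq_mul_inv]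
    _ ≤ _ := Finset.sum_le_sum fun l hl =>
        ENNReal.ofReal_le_ofReal (le_mseq (Finset.mem_range.1 hl))

theorem le_pseq {k : ℕ} (hk : 1 ≤ k) : 1 / 504 ≤ pseq k := by
  have hd := dseq_pos hk
  have hw := one_le_wseq hk
  have h1 := dseq_le k
  have h2 : (k : ℝ) ^ 4 / 28 ≤ dseq (k + 1) := by
    refine le_trans ?_ (le_dseq (k + 1))
    push_cast
    gcongr
    linarith
  have hd2 : 0 ≤ dseq (k + 1) := (dseq_pos (by omega)).le
  unfold pseq
  rw [le_div_iff₀ (by positivity)]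
  have : 1 ≤ wseq k ^ 2 := one_le_pow₀ hw
  nlinarith

theorem pseq_le {k : ℕ} (hk : 1 ≤ k) : pseq k ≤ 224 := by
  have hk' : (1 : ℝ) ≤ k := by exact_mod_cast hk
  have hd := dseq_pos hk
  have hw := wseq_le_two k
  have h1 := le_dseq k
  have h2 : dseq (k + 1) ≤ 24 * (k : ℝ) ^ 4 := by
    refine (dseq_le _).trans ?_
    push_cast
    have : ((k : ℝ) + 1) ^ 4 ≤ (2 * k) ^ 4 := by gcongr; linarith
    linarith [this, mul_pow (2 : ℝ) (k : ℝ) 4]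
  have hd2 : 0 ≤ dseq (k + 1) := (dseq_pos (by omega)).le
  unfold pseq
  rw [div_le_iff₀ (by positivity)]
  have : wseq k ^ 2 ≤ 2 ^ 2 := pow_le_pow_left₀ (wseq_nonneg k) hw 2
  nlinarith

/-- The expected sojourn time at level `k` is of linear order. -/
theorem sigE_bounds : ∃ a b : ℝ, 0 < a ∧ 0 < b ∧ ∀ k : ℕ, 1 ≤ k →
    ENNReal.ofReal (a * k) ≤ sigE k ∧ sigE k ≤ ENNReal.ofReal (b * k) := by
  refine ⟨1 / 451584 / 224, 3528 * 504, by norm_num, by norm_num, fun k hk => ?_⟩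
  have hp := le_pseq hk
  have hp' := pseq_le hk
  have hp0 : 0 < pseq k := by linarith
  constructor
  · calc ENNReal.ofReal (1 / 451584 / 224 * k)
        ≤ ENNReal.ofReal (k / 451584 / pseq k) := by
          refine ENNReal.ofReal_le_ofReal ?_
          calc (1 / 451584 / 224 * k : ℝ) = k / 451584 / 224 := by ring
            _ ≤ _ := by gcongr
      _ = ENNReal.ofReal (k / 451584) / ENNReal.ofReal (pseq k) :=
          ENNReal.ofReal_div_of_pos hp0
      _ ≤ _ := ENNReal.div_le_div_right (le_tsum_mseq k) _
  · calc sigE k ≤ ENNReal.ofReal (3528 * k) / ENNReal.ofReal (pseq k) :=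
          ENNReal.div_le_div_right (tsum_mseq_le hk) _
      _ = ENNReal.ofReal (3528 * k / pseq k) := (ENNReal.ofReal_div_of_pos hp0).symm
      _ ≤ _ := by
          refine ENNReal.ofReal_le_ofReal ?_
          calc (3528 * k / pseq k : ℝ) ≤ 3528 * k / (1 / 504) := by gcongr
            _ = _ := by ring

/-- The potential of a source of at most linear growth has at most cubic growth. -/
theorem potential_le {s : ℕ → ℝ≥0∞} {b : ℝ} (hb : 0 < b) (hs0 : s 0 = 0)
    (hs : ∀ k : ℕ, 1 ≤ k → s k ≤ ENNReal.ofReal (b * k)) {j : ℕ} (hj : 1 ≤ j) :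
    ∑' L, walkMass s L j ≤ ENNReal.ofReal (b * 20 * (j : ℝ) ^ 3) := by
  have hφ : ∀ k, 0 ≤ b * cubic k := fun k => mul_nonneg hb.le (cubic_nonneg k)
  have hsup : ∀ k, s k + stepApply (fun k => ENNReal.ofReal (b * cubic k / wseq k)) k ≤
      ENNReal.ofReal (b * cubic k / wseq k) := by
    rintro (_ | l)
    · simp [hs0, stepApply_zero]
    · rw [stepApply_ofReal_div hφ (by simp [cubic_zero])]
      refine (add_le_add (hs (l + 1) (by omega)) le_rfl).trans ?_
      have := hφ l
      have := hφ (l + 1)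
      have := hφ (l + 2)
      have := wseq_nonneg (l + 1)
      rw [← ENNReal.ofReal_add (by positivity) (by positivity)]
      refine ENNReal.ofReal_le_ofReal ?_
      have h := mul_le_mul_of_nonneg_left (le_cubic_defect l) hb.le
      rw [mul_div_assoc]
      linarith
  refine (tsum_walkMass_le hsup hj).trans (ENNReal.ofReal_le_ofReal ?_)
  calc b * cubic j / wseq j ≤ b * cubic j :=
        div_le_self (hφ j) (one_le_wseq hj)
    _ ≤ b * (20 * (j : ℝ) ^ 3) := by gcongr; exact cubic_le j
    _ = _ := by ring

/-- A cubic minus a quartic is bounded by a multiple of the identity. -/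
theorem cubic_sub_quartic_le {δ x : ℝ} (hδ : 0 < δ) (hx : 0 ≤ x) :
    20 * x ^ 3 - δ * x ^ 4 ≤ 20 * (20 / δ) ^ 2 * x := by
  rcases le_total x (20 / δ) with h | h
  · have h2 : x ^ 2 ≤ (20 / δ) ^ 2 := pow_le_pow_left₀ hx h 2
    have h3 : x ^ 2 * x ≤ (20 / δ) ^ 2 * x := mul_le_mul_of_nonneg_right h2 hx
    have h4 : 0 ≤ δ * x ^ 4 := by positivity
    nlinarith
  · have h1 : 20 ≤ x * δ := (div_le_iff₀ hδ).1 h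
    have h2 : 0 ≤ (x * δ - 20) * x ^ 3 := mul_nonneg (by linarith) (by positivity)
    have h3 : 0 ≤ 20 * (20 / δ) ^ 2 * x := by positivity
    nlinarith

/-- The potential of a source of at least linear growth has at least cubic growth. -/
theorem le_potential {s : ℕ → ℝ≥0∞} {a : ℝ} (ha : 0 < a)
    (hs : ∀ k : ℕ, 1 ≤ k → ENNReal.ofReal (a * k) ≤ s k)
    {j : ℕ} (hj : 1 ≤ j) (hfin : ∑' L, walkMass s L j ≠ ⊤) :
    ENNReal.ofReal (a / 32 * (j : ℝ) ^ 3) ≤ ∑' L, walkMass s L j := by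
  have hj' : (0 : ℝ) < j := by exact_mod_cast hj
  have hcj : 0 < cubic j := lt_of_lt_of_le (by positivity) (le_cubic j)
  have hdj := dseq_pos hj
  set ε : ℝ := cubic j / (2 * dseq j) with hε
  have hε0 : 0 < ε := by positivity
  set φ : ℕ → ℝ := fun k => a / 8 * max (cubic k - ε * dseq k) 0 with hφdef
  have hφ : ∀ k, 0 ≤ φ k := fun k => mul_nonneg (by positivity) (le_max_right _ _)
  have hφ0 : φ 0 = 0 := by simp [hφdef, cubic_zero, dseq_zero]
  have hφge : ∀ k, a / 8 * (cubic k - ε * dseq k) ≤ φ k := fun k =>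
    mul_le_mul_of_nonneg_left (le_max_left _ _) (by positivity)
  have hsub : ∀ k, ENNReal.ofReal (φ k / wseq k) ≤
      s k + stepApply (fun k => ENNReal.ofReal (φ k / wseq k)) k := by
    rintro (_ | l)
    · simp [hφ0]
    · rw [stepApply_ofReal_div hφ hφ0]
      refine le_trans ?_ (add_le_add (hs (l + 1) (by omega)) le_rfl)
      have h0 := hφ l
      have h1 := hφ (l + 1)
      have h2 := hφ (l + 2)
      have hw := wseq_nonneg (l + 1)
      rw [← ENNReal.ofReal_add (by positivity) (by positivity)]
      refine ENNReal.ofReal_le_ofReal ?_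
      rcases le_total (cubic (l + 1) - ε * dseq (l + 1)) 0 with h | h
      · have : φ (l + 1) = 0 := by simp [hφdef, max_eq_right h]
        rw [this] at h1 ⊢
        rw [zero_div]
        positivity
      · have he : φ (l + 1) = a / 8 * (cubic (l + 1) - ε * dseq (l + 1)) := by
          simp [hφdef, max_eq_left h]
        have hsum : wseq (l + 1) / 12 * (a / 8 * (cubic l - ε * dseq l) +
            a / 8 * (cubic (l + 1) - ε * dseq (l + 1)) +
            a / 8 * (cubic (l + 2) - ε * dseq (l + 2))) ≤
            wseq (l + 1) / 12 * (φ l + φ (l + 1) + φ (l + 2)) := by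
          have := hφge l
          have := hφge (l + 1)
          have := hφge (l + 2)
          gcongr
        refine le_trans ?_ (add_le_add le_rfl hsum)
        have hc := mul_le_mul_of_nonneg_left (cubic_defect_le l) (show 0 ≤ a / 8 by positivity)
        have hd := congrArg (fun y => a / 8 * ε * y) (dseq_div_wseq l)
        have hsplit : φ (l + 1) / wseq (l + 1) = a / 8 * (cubic (l + 1) / wseq (l + 1)) -
            a / 8 * ε * (dseq (l + 1) / wseq (l + 1)) := by rw [he]; ring
        rw [hsplit, hd]
        linarith
  set K : ℝ := 20 * (20 / (ε / 28)) ^ 2 with hK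
  have hK0 : 0 ≤ K := by positivity
  have hdom : ∀ k, ENNReal.ofReal (φ k / wseq k) ≤ ENNReal.ofReal (K / 8) * s k := by
    intro k
    rcases Nat.eq_zero_or_pos k with rfl | hk
    · simp [hφ0]
    · refine le_trans ?_ (mul_le_mul_right (hs k hk) _)
      rw [← ENNReal.ofReal_mul (by positivity)]
      refine ENNReal.ofReal_le_ofReal ((div_le_self (hφ k) (one_le_wseq hk)).trans ?_)
      have hmax : max (cubic k - ε * dseq k) 0 ≤ K * k := by
        refine max_le ?_ (by positivity)
        have h1 := cubic_sub_quartic_le (show 0 < ε / 28 by positivity) (Nat.cast_nonneg (α := ℝ) k)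
        rw [← hK] at h1
        have h2 := cubic_le k
        have h3 := mul_le_mul_of_nonneg_left (le_dseq k) hε0.le
        linarith
      calc φ k ≤ a / 8 * (K * k) := mul_le_mul_of_nonneg_left hmax (by positivity)
        _ = _ := by ring
  refine le_trans (ENNReal.ofReal_le_ofReal ?_)
    (le_tsum_walkMass hsub ENNReal.ofReal_ne_top hdom hj hfin)
  have hφj : a / 16 * (j : ℝ) ^ 3 ≤ φ j := by
    refine le_trans ?_ (hφge j)
    have he : ε * dseq j = cubic j / 2 := by rw [hε]; field_simp
    rw [he]
    have := mul_le_mul_of_nonneg_left (le_cubic j) (show 0 ≤ a / 16 by positivity)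
    linarith
  rw [le_div_iff₀ (wseq_pos hj)]
  have hw := wseq_le_two j
  have : a / 32 * (j : ℝ) ^ 3 * wseq j ≤ a / 32 * (j : ℝ) ^ 3 * 2 := by gcongr
  linarith

theorem stmt17 :
    (∀ j : ℕ, 1 ≤ j →
      sigE j ≠ ⊤ ∧ (∑' k : ℕ, sigE (k + 1) * Gfun (k + 1) j) ≠ ⊤) ∧
    ∃ c C : ℝ, 0 < c ∧ c ≤ C ∧
      ∀ j : ℕ, 1 ≤ j →
        c * (j : ℝ) ^ 3 ≤
            2 * (∑' k : ℕ, sigE (k + 1) * Gfun (k + 1) j).toReal -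
              (sigE j).toReal ∧
        2 * (∑' k : ℕ, sigE (k + 1) * Gfun (k + 1) j).toReal -
              (sigE j).toReal ≤ C * (j : ℝ) ^ 3 := by
  obtain ⟨a, b, ha, hb, hσ⟩ := sigE_bounds
  set s : ℕ → ℝ≥0∞ := fun k => if k = 0 then 0 else sigE k with hs
  have hspos : ∀ k, 1 ≤ k → s k = sigE k := fun k hk => if_neg (by omega)
  have hT : ∀ j, ∑' k : ℕ, sigE (k + 1) * Gfun (k + 1) j = ∑' L, walkMass s L j := fun j => by
    rw [← tsum_mul_Gfun, tsum_eq_zero_add' (f := fun k => s k * Gfun k j) ENNReal.summable]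
    simp [hs]
  have hup : ∀ j : ℕ, 1 ≤ j → ∑' L, walkMass s L j ≤ ENNReal.ofReal (b * 20 * (j : ℝ) ^ 3) :=
    fun j hj => potential_le hb rfl (fun k hk => hspos k hk ▸ (hσ k hk).2) hj
  have hfin : ∀ j, 1 ≤ j → ∑' L, walkMass s L j ≠ ⊤ := fun j hj =>
    ((hup j hj).trans_lt ENNReal.ofReal_lt_top).ne
  have hlow : ∀ j : ℕ, 1 ≤ j →
      ENNReal.ofReal (a / 32 * (j : ℝ) ^ 3) ≤ ∑' L, walkMass s L j := fun j hj =>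
    le_potential ha (fun k hk => hspos k hk ▸ (hσ k hk).1) hj (hfin j hj)
  have hσle : ∀ j, 1 ≤ j → sigE j ≤ ∑' L, walkMass s L j := fun j hj => by
    rw [← hspos j hj, ← walkMass_zero s hj]
    exact ENNReal.le_tsum 0
  have hbounds : ∀ j : ℕ, 1 ≤ j →
      a / 32 * (j : ℝ) ^ 3 ≤ (∑' L, walkMass s L j).toReal ∧
      (∑' L, walkMass s L j).toReal ≤ b * 20 * (j : ℝ) ^ 3 ∧
      (sigE j).toReal ≤ (∑' L, walkMass s L j).toReal := fun j hj =>
    ⟨(ENNReal.ofReal_le_iff_le_toReal (hfin j hj)).1 (hlow j hj),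
      ENNReal.toReal_le_of_le_ofReal (by positivity) (hup j hj),
      ENNReal.toReal_mono (hfin j hj) (hσle j hj)⟩
  simp only [hT]
  refine ⟨fun j hj => ⟨((hσle j hj).trans_lt (hfin j hj).lt_top).ne, hfin j hj⟩,
    a / 32, b * 40, by positivity, ?_, fun j hj => ?_⟩
  · obtain ⟨h1, h2, -⟩ := hbounds 1 le_rfl
    norm_num at h1 h2
    linarith
  · obtain ⟨h1, h2, h3⟩ := hbounds j hj
    have := ENNReal.toReal_nonneg (a := sigE j)
    constructor <;> linarith
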